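/- For every μ₁, μ₂, μ₃ ∈ M(X), the functional H satisfies the triangle inequality H(μ₁, μ₃) ≤ H(μ₁, μ₂) + H(μ₂, μ₃). -/

import Mathlib

open MeasureTheory Set Filter Topology
open scoped ENNReal NNReal Classical

noncomputable section

/-- Euclidean space `ℝ^d`. -/
abbrev Ed (d : ℕ) := EuclideanSpace ℝ (Fin d)

/-- The space `M_d` of real `d × d` matrices. -/
abbrev Matd (d : ℕ) := Matrix (Fin d) (Fin d) ℝ

/-- The Frobenius inner product `A : B = tr(Aᵀ B)`. -/
def frob {d : ℕ} (A B : Matd d) : ℝ := ∑ i, ∑ j, A i j * B i j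

/-- The Frobenius norm of a matrix. -/
def matnorm {d : ℕ} (A : Matd d) : ℝ := Real.sqrt (frob A A)

/-- The Hessian matrix `∇²φ(x)`. -/
def hess {d : ℕ} (φ : Ed d → ℝ) (x : Ed d) : Matd d :=
  fun i j => iteratedFDeriv ℝ 2 φ x ![EuclideanSpace.single i 1, EuclideanSpace.single j 1]

/-- `φ ∈ C²_c(ℝ^d)`. -/
def IsC2c {d : ℕ} (φ : Ed d → ℝ) : Prop := ContDiff ℝ 2 φ ∧ HasCompactSupport φ

/-- Assumption (A1): `dom f ⊆ S⁺_d`, `f` is coercive and sublinear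
(subadditive and positively 1-homogeneous). -/
def CostA1 {d : ℕ} (f : Matd d → ℝ≥0∞) : Prop :=
  (∀ M, f M ≠ ⊤ → M.PosSemidef) ∧
  (∃ c : ℝ, 0 < c ∧ ∀ M, ENNReal.ofReal (c * matnorm M) ≤ f M) ∧
  (∀ A B, f (A + B) ≤ f A + f B) ∧
  (∀ t : ℝ, 0 ≤ t → ∀ A, f (t • A) = ENNReal.ofReal t * f A)

/-- Assumption (A2): `f` is lower semicontinuous. -/
def CostA2 {d : ℕ} (f : Matd d → ℝ≥0∞) : Prop := LowerSemicontinuous f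

/-- `dom(f⋆) = {A | A : M ≤ f(M) for all M ∈ dom f}`. -/
def domFstar {d : ℕ} (f : Matd d → ℝ≥0∞) : Set (Matd d) :=
  { A | ∀ M, f M ≠ ⊤ → ENNReal.ofReal (frob A M) ≤ f M }

/-- A competitor `λ = ρ·m` (an `S⁺_d`-valued measure supported in `X`) for the static problem:
`tr(½∇²λ) = ν − μ` in the distributional sense. -/
def IsStaticCompetitor {d : ℕ} (X : Set (Ed d)) (μ ν : Measure (Ed d))
    (m : Measure (Ed d)) (ρ : Ed d → Matd d) : Prop :=
  IsFiniteMeasure m ∧ m Xᶜ = 0 ∧ (∀ x, (ρ x).PosSemidef) ∧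
    ∀ φ : Ed d → ℝ, IsC2c φ →
      ∫ x, (1/2 : ℝ) * frob (hess φ x) (ρ x) ∂m = ∫ x, φ x ∂ν - ∫ x, φ x ∂μ

/-- The static value `F(μ,ν)` (using the positive 1-homogeneity of `f`, the cost of
`λ = ρ·m` is `∫ f(dλ/d|λ|) d|λ| = ∫ f(ρ) dm`). -/
def Fstat {d : ℕ} (f : Matd d → ℝ≥0∞) (X : Set (Ed d)) (μ ν : Measure (Ed d)) : ℝ≥0∞ :=
  sInf { c | ∃ m ρ, IsStaticCompetitor X μ ν m ρ ∧ c = ∫⁻ x, f (ρ x) ∂m }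

/-- `(ϱ, λ)`, with `ϱ = ϱ_t ⊗ L¹⌞(0,1)` and `λ = (ρ_t · m_t) ⊗ L¹⌞(0,1)` an `S⁺_d`-valued
measure, solves the Fokker–Planck equation `∂_t ϱ = tr(½∇²λ)` on `(0,1) × ℝ^d`. -/
def SolvesFPE {d : ℕ} (ϱ : ℝ → Measure (Ed d)) (m : ℝ → Measure (Ed d))
    (ρ : ℝ → Ed d → Matd d) : Prop :=
  (∀ t ∈ Ioo (0:ℝ) 1, IsFiniteMeasure (ϱ t) ∧ IsFiniteMeasure (m t)) ∧
  (∀ t ∈ Ioo (0:ℝ) 1, ∀ x, (ρ t x).PosSemidef) ∧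
  (∀ A : Set (Ed d), IsCompact A →
    (∫⁻ t in Ioo (0:ℝ) 1, ∫⁻ x in A, ENNReal.ofReal (matnorm (ρ t x)) ∂(m t)) < ⊤) ∧
  (∀ φ : ℝ × Ed d → ℝ, ContDiff ℝ 2 φ → HasCompactSupport φ →
    tsupport φ ⊆ Ioo (0:ℝ) 1 ×ˢ (univ : Set (Ed d)) →
    (∫ t in Ioo (0:ℝ) 1, ∫ x, fderiv ℝ φ (t, x) (1, 0) ∂(ϱ t)) =
      - ∫ t in Ioo (0:ℝ) 1, ∫ x, (1/2 : ℝ) * frob (hess (fun y => φ (t, y)) x) (ρ t x) ∂(m t))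

/-- The support condition (⋆): `supp ϱ_t, supp λ_t ⊆ X` for a.e. `t ∈ (0,1)`. -/
def SuppCond {d : ℕ} (X : Set (Ed d)) (ϱ m : ℝ → Measure (Ed d)) : Prop :=
  ∀ᵐ t ∂(volume.restrict (Ioo (0:ℝ) 1)), (ϱ t) Xᶜ = 0 ∧ (m t) Xᶜ = 0

/-- `μ` is the weak* (narrow) limit of `ϱ_t` as `t → t₀` within `(0,1)`. -/
def NarrowLim {d : ℕ} (ϱ : ℝ → Measure (Ed d)) (t₀ : ℝ) (μ : Measure (Ed d)) : Prop :=
  ∀ g : BoundedContinuousFunction (Ed d) ℝ,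
    Tendsto (fun t => ∫ x, g x ∂(ϱ t)) (𝓝[Ioo (0:ℝ) 1] t₀) (𝓝 (∫ x, g x ∂μ))

/-- The dynamic (Benamou–Brenier type) value `F(μ,ν)`. -/
def Fdyn {d : ℕ} (f : Matd d → ℝ≥0∞) (X : Set (Ed d)) (μ ν : Measure (Ed d)) : ℝ≥0∞ :=
  sInf { c | ∃ ϱ m ρ, SolvesFPE ϱ m ρ ∧ SuppCond X ϱ m ∧
      NarrowLim ϱ 0 μ ∧ NarrowLim ϱ 1 ν ∧
      c = ∫⁻ t in Ioo (0:ℝ) 1, ∫⁻ x, f (ρ t x) ∂(m t) }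

/-- the cost `G(x,p) := F(δ_x, p)`. -/
def Gcost {d : ℕ} (f : Matd d → ℝ≥0∞) (X : Set (Ed d)) (x : Ed d)
    (p : Measure (Ed d)) : ℝ≥0∞ :=
  Fstat f X (Measure.dirac x) p

/-- A disintegration kernel `x ↦ γ^x` of a transport plan `γ ∈ Π(μ,ν)`. -/
def IsTransportKernel {d : ℕ} (X : Set (Ed d)) (μ ν : Measure (Ed d))
    (κ : Ed d → Measure (Ed d)) : Prop :=
  (∀ x, IsProbabilityMeasure (κ x) ∧ (κ x) Xᶜ = 0) ∧
  (∀ A : Set (Ed d), MeasurableSet A → Measurable fun x => κ x A) ∧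
  (∀ A : Set (Ed d), MeasurableSet A → ∫⁻ x, κ x A ∂μ = ν A)

/-- The static optimal transport value `H(μ,ν) = inf_{γ ∈ Π(μ,ν)} ∫ G(x,γ^x) dμ`. -/
def Hcost {d : ℕ} (f : Matd d → ℝ≥0∞) (X : Set (Ed d)) (μ ν : Measure (Ed d)) : ℝ≥0∞ :=
  sInf { c | ∃ κ, IsTransportKernel X μ ν κ ∧ c = ∫⁻ x, Gcost f X x (κ x) ∂μ }

/-- Integral of `φ` against a signed measure. -/
def sInt {d : ℕ} (s : SignedMeasure (Ed d)) (φ : Ed d → ℝ) : ℝ :=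
  ∫ x, φ x ∂s.toJordanDecomposition.posPart - ∫ x, φ x ∂s.toJordanDecomposition.negPart

/-- A signed measure is supported in `X`. -/
def SuppInX {d : ℕ} (X : Set (Ed d)) (s : SignedMeasure (Ed d)) : Prop :=
  ∀ A : Set (Ed d), MeasurableSet A → A ⊆ Xᶜ → s A = 0

/-- The extension of `F` to signed measures: `+∞` unless `μ, ν ≥ 0` with equal masses. -/
def FSgn {d : ℕ} (f : Matd d → ℝ≥0∞) (X : Set (Ed d)) (μ ν : SignedMeasure (Ed d)) : ℝ≥0∞ :=
  if 0 ≤ μ ∧ 0 ≤ ν ∧ μ univ = ν univ then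
    Fstat f X μ.toJordanDecomposition.posPart ν.toJordanDecomposition.posPart
  else ⊤

/-- The extension of `H` to signed measures: `+∞` unless `μ, ν ≥ 0` with equal masses. -/
def HSgn {d : ℕ} (f : Matd d → ℝ≥0∞) (X : Set (Ed d)) (μ ν : SignedMeasure (Ed d)) : ℝ≥0∞ :=
  if 0 ≤ μ ∧ 0 ≤ ν ∧ μ univ = ν univ then
    Hcost f X μ.toJordanDecomposition.posPart ν.toJordanDecomposition.posPart
  else ⊤

/-- The weak* topology on signed measures, in duality with continuous functions. -/
def weakStarTop (d : ℕ) : TopologicalSpace (SignedMeasure (Ed d)) :=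
  ⨅ g : C(Ed d, ℝ), TopologicalSpace.induced (fun s => sInt s g) inferInstance

/-- The `G`-transform `φ^G(x) = inf { ∫ φ dp + G(x,p) : p ∈ P(X) }`. -/
def GTrans {d : ℕ} (f : Matd d → ℝ≥0∞) (X : Set (Ed d)) (φ : Ed d → ℝ) (x : Ed d) : EReal :=
  sInf { c : EReal | ∃ p : Measure (Ed d), IsProbabilityMeasure p ∧ p Xᶜ = 0 ∧
      c = ((∫ y, φ y ∂p : ℝ) : EReal) + (Gcost f X x p : EReal) }

/-- `φ = φ^G` on `E`. -/
def GEq {d : ℕ} (f : Matd d → ℝ≥0∞) (X : Set (Ed d)) (φ : Ed d → ℝ) (E : Set (Ed d)) : Prop :=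
  ∀ x ∈ E, GTrans f X φ x = ((φ x : ℝ) : EReal)

/-- `𝒯(A) = sup { A : M | M ∈ S⁺⁺_d, f(M) = 1 }`. -/
def Tcal {d : ℕ} (f : Matd d → ℝ≥0∞) (A : Matd d) : EReal :=
  sSup { c : EReal | ∃ M : Matd d, M.PosDef ∧ f M = 1 ∧ c = ((frob A M : ℝ) : EReal) }

/-- `u` is a viscosity supersolution of `c − 𝒯(½∇²u) = 0` in `U`. -/
def IsViscSupersol {d : ℕ} (f : Matd d → ℝ≥0∞) (c : ℝ) (u : Ed d → ℝ) (U : Set (Ed d)) : Prop :=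
  ∀ φ : Ed d → ℝ, ContDiffOn ℝ 2 φ U → ∀ x ∈ U,
    IsLocalMinOn (fun y => u y - φ y) U x →
    Tcal f ((1/2 : ℝ) • hess φ x) ≤ ((c : ℝ) : EReal)

/-- Integral of an `EReal`-valued function against a measure
(positive part minus negative part). -/
def erealInt {d : ℕ} (m : Measure (Ed d)) (u : Ed d → EReal) : EReal :=
  ((∫⁻ y, ENNReal.ofReal ((u y).toReal) ∂m : ℝ≥0∞) : EReal) -
    ((∫⁻ y, (if u y = ⊥ then (⊤ : ℝ≥0∞) else ENNReal.ofReal (-(u y).toReal)) ∂m : ℝ≥0∞) : EReal)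

/-- `u : U → ℝ ∪ {−∞}` is subharmonic on the open set `U`: it is upper semicontinuous,
not identically `−∞` on any connected component, and satisfies the sub-mean value
inequality on spheres. -/
def Subharmonic {d : ℕ} (U : Set (Ed d)) (u : Ed d → EReal) : Prop :=
  (∀ x, u x ≠ ⊤) ∧
  (∀ x ∈ U, ∃ y ∈ connectedComponentIn U x, u y ≠ ⊥) ∧
  UpperSemicontinuousOn u U ∧
  (∀ x ∈ U, ∀ r : ℝ, 0 < r → Metric.closedBall x r ⊆ U →
    (((μH[(d : ℝ) - 1] (Metric.sphere x r)).toReal : ℝ) : EReal) * u x ≤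
      erealInt ((μH[(d : ℝ) - 1]).restrict (Metric.sphere x r)) u)

/-- The (topological) support of a measure. -/
def msupp {d : ℕ} (m : Measure (Ed d)) : Set (Ed d) :=
  { x | ∀ U : Set (Ed d), IsOpen U → x ∈ U → m U ≠ 0 }

/-- `m₁ ≤_SH m₂`: subharmonic order. -/
def SHOrder {d : ℕ} (m₁ m₂ : Measure (Ed d)) : Prop :=
  ∀ U : Set (Ed d), IsOpen U → msupp (m₁ + m₂) ⊆ U →
    ∀ u : Ed d → EReal, Subharmonic U u →
      erealInt (m₁.restrict U) u ≤ erealInt (m₂.restrict U) u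

/-- The second moment matrix `∫ x ⊗ x dκ`. -/
def secondMoment {d : ℕ} (κ : Measure (Ed d)) : Matd d :=
  fun i j => ∫ x, x i * x j ∂κ

end

noncomputable section

open CompactlySupported in
lemma riesz_aux {Y : Type*} [TopologicalSpace Y] [CompactSpace Y] [T2Space Y]
    [MeasurableSpace Y] [BorelSpace Y] (Λ : C(Y, ℝ) →ₗ[ℝ] ℝ) (hΛ : ∀ g, 0 ≤ g → 0 ≤ Λ g) :
    ∃ η : Measure Y, IsFiniteMeasure η ∧ ∀ g : C(Y, ℝ), ∫ y, g y ∂η = Λ g := by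
  let T : C_c(Y, ℝ) →ₗ[ℝ] C(Y, ℝ) :=
    { toFun := fun g => g.toContinuousMap
      map_add' := fun _ _ => rfl
      map_smul' := fun _ _ => rfl }
  let P : C_c(Y, ℝ) →ₚ[ℝ] ℝ := PositiveLinearMap.mk₀ (Λ ∘ₗ T) (fun g hg => hΛ _ hg)
  refine ⟨RealRMK.rieszMeasure P, ?_, fun g => ?_⟩
  · have : IsFiniteMeasureOnCompacts (RealRMK.rieszMeasure P) := by
      unfold RealRMK.rieszMeasure; infer_instance
    exact ⟨isCompact_univ.measure_lt_top⟩
  · have := RealRMK.integral_rieszMeasure P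
      (CompactlySupportedContinuousMap.continuousMapEquiv g)
    exact this

lemma rep_aux {Y : Type*} [TopologicalSpace Y] [CompactSpace Y] [T2Space Y]
    [MeasurableSpace Y] [BorelSpace Y] {V : Type*} [AddCommGroup V] [Module ℝ V]
    (A : V →ₗ[ℝ] C(Y, ℝ)) (L : V →ₗ[ℝ] ℝ) (C : ℝ) (hC : 0 ≤ C)
    (h : ∀ v, (∀ y, A v y ≤ 1) → L v ≤ C) :
    ∃ η : Measure Y, IsFiniteMeasure η ∧ η univ ≤ ENNReal.ofReal C ∧
      ∀ v, ∫ y, A v y ∂η = L v := by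
  have h1 : ∀ v s, 0 < s → (∀ y, A v y ≤ s) → L v ≤ C * s := by
    intro v s hs hv
    have := h (s⁻¹ • v) (fun y => by
      simp only [map_smul, ContinuousMap.smul_apply, smul_eq_mul]
      rw [inv_mul_le_iff₀ hs]; simpa using hv y)
    simp only [map_smul, smul_eq_mul] at this
    rw [inv_mul_le_iff₀ hs] at this
    linarith
  have h2 : ∀ v s, 0 ≤ s → (∀ y, A v y ≤ s) → L v ≤ C * s := by
    intro v s hs hv
    have ht : Tendsto (fun e : ℝ => C * (s + e)) (𝓝[>] 0) (𝓝 (C * (s + 0))) := by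
      have : Continuous (fun e : ℝ => C * (s + e)) := by fun_prop
      exact (this.tendsto 0).mono_left nhdsWithin_le_nhds
    rw [add_zero] at ht
    refine ge_of_tendsto ht ?_
    filter_upwards [self_mem_nhdsWithin] with e he
    have he' : (0:ℝ) < e := he
    exact h1 v _ (by linarith) (fun y => by linarith [hv y])
  let N : C(Y, ℝ) → ℝ := fun g => C * ‖g ⊔ 0‖
  have hNle : ∀ (g : C(Y, ℝ)) y, g y ≤ ‖g ⊔ 0‖ := by
    intro g y
    have := ContinuousMap.norm_coe_le_norm (g ⊔ 0) y
    have h3 : (g ⊔ 0) y = g y ⊔ 0 := rfl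
    rw [h3, Real.norm_eq_abs] at this
    exact le_trans (le_trans le_sup_left (le_abs_self _)) this
  have hN : ∀ (g : C(Y, ℝ)) s, 0 ≤ s → (∀ y, g y ≤ s) → ‖g ⊔ 0‖ ≤ s := by
    intro g s hs hg
    rw [ContinuousMap.norm_le _ hs]
    intro y
    have h3 : (g ⊔ 0) y = g y ⊔ 0 := rfl
    rw [h3, Real.norm_eq_abs, abs_of_nonneg le_sup_right]
    exact sup_le (hg y) hs
  obtain ⟨s, hs⟩ := LinearMap.exists_rightInverse_of_surjective A.rangeRestrict
    (LinearMap.range_rangeRestrict A)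
  have hs' : ∀ y : LinearMap.range A, A (s y) = y := fun y => by
    have := congrArg Subtype.val (LinearMap.congr_fun hs y)
    simpa using this
  obtain ⟨Λ, hΛ1, hΛ2⟩ := exists_extension_of_le_sublinear
    (⟨LinearMap.range A, L ∘ₗ s⟩ : C(Y, ℝ) →ₗ.[ℝ] ℝ) N
    (by
      intro c hc g
      have : (c • g) ⊔ 0 = c • (g ⊔ 0) := by
        ext y
        change (c * g y) ⊔ 0 = c * (g y ⊔ 0)
        rw [mul_max_of_nonneg _ _ hc.le, mul_zero]
      simp only [N, this, norm_smul, Real.norm_eq_abs, abs_of_pos hc]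
      ring)
    (by
      intro g k
      simp only [N]
      rw [← mul_add]
      refine mul_le_mul_of_nonneg_left ?_ hC
      refine hN _ _ (by positivity) (fun y => ?_)
      exact add_le_add (hNle g y) (hNle k y))
    (by
      intro y
      change L (s y) ≤ C * ‖(y : C(Y, ℝ)) ⊔ 0‖
      refine h2 _ _ (norm_nonneg _) (fun z => ?_)
      rw [hs']; exact hNle _ z)
  have hpos : ∀ g, 0 ≤ g → 0 ≤ Λ g := by
    intro g hg
    have h3 := hΛ2 (-g)
    have h4 : ‖(-g) ⊔ 0‖ ≤ 0 := hN _ _ le_rfl (fun y => by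
      have : 0 ≤ g y := hg y
      simpa using this)
    have h5 : N (-g) ≤ 0 := mul_nonpos_of_nonneg_of_nonpos hC h4
    rw [map_neg] at h3
    linarith
  obtain ⟨η, hη, hη2⟩ := riesz_aux Λ hpos
  refine ⟨η, hη, ?_, fun v => ?_⟩
  · have h3 := hη2 1
    have h4 : Λ 1 ≤ C := (hΛ2 1).trans (by
      have : ‖(1 : C(Y, ℝ)) ⊔ 0‖ ≤ 1 := hN _ _ zero_le_one (fun y => le_rfl)
      calc N 1 ≤ C * 1 := mul_le_mul_of_nonneg_left this hC
        _ = C := mul_one C)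
    simp only [ContinuousMap.one_apply, integral_const, smul_eq_mul, mul_one] at h3
    rw [← ENNReal.ofReal_toReal (measure_ne_top η univ)]
    exact ENNReal.ofReal_le_ofReal (by rw [← h3] at h4; exact h4)
  · rw [hη2, hΛ1 ⟨A v, LinearMap.mem_range_self A v⟩]
    change L (s ⟨A v, LinearMap.mem_range_self A v⟩) = L v
    set w := s ⟨A v, LinearMap.mem_range_self A v⟩
    have hw : A w = A v := hs' _
    have e1 := h2 (w - v) 0 le_rfl (fun y => by simp [hw])
    have e2 := h2 (v - w) 0 le_rfl (fun y => by simp [hw])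
    simp only [map_sub, mul_zero] at e1 e2
    linarith

/-- admissible dual potentials -/
def Adm {d : ℕ} (f : Matd d → ℝ≥0∞) (X : Set (Ed d)) (φ : Ed d → ℝ) : Prop :=
  IsC2c φ ∧ ∀ x ∈ X, ∀ M : Matd d, f M ≤ 1 → (1/2 : ℝ) * frob (hess φ x) M ≤ 1

lemma frob_smul_right {d : ℕ} (t : ℝ) (A B : Matd d) : frob A (t • B) = t * frob A B := by
  simp only [frob, Matrix.smul_apply, smul_eq_mul, Finset.mul_sum]
  refine Finset.sum_congr rfl fun i _ => Finset.sum_congr rfl fun j _ => by ring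

lemma abs_entry_le {d : ℕ} (M : Matd d) (i j : Fin d) : |M i j| ≤ matnorm M := by
  unfold matnorm frob
  apply Real.abs_le_sqrt
  have h1 : M i j ^ 2 ≤ ∑ j, M i j * M i j := by
    have := Finset.single_le_sum (f := fun j => M i j * M i j)
      (fun k _ => mul_self_nonneg _) (Finset.mem_univ j)
    simpa [sq] using this
  refine h1.trans ?_
  exact Finset.single_le_sum (f := fun i => ∑ j, M i j * M i j)
      (fun k _ => Finset.sum_nonneg fun l _ => mul_self_nonneg _) (Finset.mem_univ i)

lemma weak_duality {d : ℕ} {f : Matd d → ℝ≥0∞} (hA1 : CostA1 f) {X : Set (Ed d)}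
    (μ ν : Measure (Ed d)) {φ : Ed d → ℝ} (hφ : Adm f X φ) :
    ENNReal.ofReal (∫ x, φ x ∂ν - ∫ x, φ x ∂μ) ≤ Fstat f X μ ν := by
  refine le_sInf ?_
  rintro c ⟨m, ρ, ⟨hm, hmX, hpsd, hcomp⟩, rfl⟩
  rw [← hcomp φ hφ.1]
  obtain ⟨-, ⟨c, hc, hcoer⟩, -, hhom⟩ := hA1
  set g : Ed d → ℝ := fun x => (1/2 : ℝ) * frob (hess φ x) (ρ x) with hg
  have hpt : ∀ x ∈ X, ENNReal.ofReal (g x) ≤ f (ρ x) := by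
    intro x hx
    rcases eq_or_ne (f (ρ x)) ⊤ with ht | ht
    · rw [ht]; exact le_top
    rcases eq_or_ne (f (ρ x)) 0 with h0 | h0
    · have h1 : matnorm (ρ x) ≤ 0 := by
        have := hcoer (ρ x)
        rw [h0, nonpos_iff_eq_zero, ENNReal.ofReal_eq_zero] at this
        exact nonpos_of_mul_nonpos_right this hc
      have h2 : ρ x = 0 := by
        ext i j
        have := (abs_entry_le (ρ x) i j).trans h1
        simpa using this
      simp [hg, h2, frob]
    · set t := (f (ρ x)).toReal with htt
      have htpos : 0 < t := ENNReal.toReal_pos h0 ht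
      have hft : f (ρ x) = ENNReal.ofReal t := (ENNReal.ofReal_toReal ht).symm
      have h1 : f (t⁻¹ • ρ x) ≤ 1 := by
        rw [hhom _ (by positivity), hft, ← ENNReal.ofReal_mul (by positivity),
          inv_mul_cancel₀ htpos.ne']
        simp
      have h2 := hφ.2 x hx _ h1
      rw [frob_smul_right] at h2
      rw [hft]
      apply ENNReal.ofReal_le_ofReal
      have h3 : (1/2 : ℝ) * (t⁻¹ * frob (hess φ x) (ρ x)) = t⁻¹ * g x := by simp only [hg]; ring
      rw [h3, inv_mul_le_iff₀ htpos] at h2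
      linarith
  have hae : ∀ᵐ x ∂m, x ∈ X := hmX
  have hle : ENNReal.ofReal (∫ x, g x ∂m) ≤ ∫⁻ x, ENNReal.ofReal (g x) ∂m := by
    by_cases hi : Integrable g m
    · rw [integral_eq_lintegral_pos_part_sub_lintegral_neg_part hi]
      refine (ENNReal.ofReal_le_ofReal (sub_le_self _ ENNReal.toReal_nonneg)).trans ?_
      exact ENNReal.ofReal_toReal_le
    · rw [integral_undef hi]; simp
  exact hle.trans (lintegral_mono_ae (hae.mono hpt))

lemma hess_add {d : ℕ} {φ ψ : Ed d → ℝ} (hφ : IsC2c φ) (hψ : IsC2c ψ) (x : Ed d) :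
    hess (φ + ψ) x = hess φ x + hess ψ x := by
  ext i j
  simp only [hess, Matrix.add_apply]
  rw [iteratedFDeriv_add_apply hφ.1.contDiffAt hψ.1.contDiffAt]
  rfl

lemma hess_smul {d : ℕ} {φ : Ed d → ℝ} (c : ℝ) (hφ : IsC2c φ) (x : Ed d) :
    hess (c • φ) x = c • hess φ x := by
  ext i j
  simp only [hess, Matrix.smul_apply]
  rw [iteratedFDeriv_const_smul_apply hφ.1.contDiffAt]
  rfl

lemma hess_cont {d : ℕ} {φ : Ed d → ℝ} (hφ : IsC2c φ) (i j : Fin d) :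
    Continuous fun x => hess φ x i j := by
  simp only [hess]
  have h := hφ.1.continuous_iteratedFDeriv (m := 2) le_rfl
  fun_prop

lemma frob_cont {d : ℕ} {φ : Ed d → ℝ} (hφ : IsC2c φ) :
    Continuous fun z : Ed d × (Fin d → Fin d → ℝ) =>
      (1/2 : ℝ) * frob (hess φ z.1) (Matrix.of z.2) := by
  unfold frob
  refine continuous_const.mul (continuous_finsetSum _ fun i _ => continuous_finsetSum _ fun j _ => ?_)
  refine ((hess_cont hφ i j).comp continuous_fst).mul ?_
  simp only [Matrix.of_apply]
  fun_prop

/-- the space of test functions -/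
def C2cSub (d : ℕ) : Submodule ℝ (Ed d → ℝ) where
  carrier := {φ | IsC2c φ}
  add_mem' := fun ha hb => ⟨ha.1.add hb.1, ha.2.add hb.2⟩
  zero_mem' := ⟨contDiff_const, HasCompactSupport.zero⟩
  smul_mem' := fun c _ ha => ⟨contDiff_const.smul ha.1, ha.2.smul_left (f := fun _ => c)⟩

lemma IsC2c.integrable {d : ℕ} {φ : Ed d → ℝ} (hφ : IsC2c φ) (μ : Measure (Ed d))
    [IsFiniteMeasure μ] : Integrable φ μ :=
  hφ.1.continuous.integrable_of_hasCompactSupport hφ.2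

/-- the unit sublevel of the cost -/
def Kset {d : ℕ} (f : Matd d → ℝ≥0∞) : Set (Fin d → Fin d → ℝ) := {M | f (Matrix.of M) ≤ 1}

lemma Kset_closed {d : ℕ} {f : Matd d → ℝ≥0∞} (hA2 : CostA2 f) : IsClosed (Kset f) :=
  LowerSemicontinuous.isClosed_preimage hA2 1

lemma Kset_compact {d : ℕ} {f : Matd d → ℝ≥0∞} (hA1 : CostA1 f) (hA2 : CostA2 f) :
    IsCompact (Kset f) := by
  obtain ⟨-, ⟨c, hc, hcoer⟩, -, -⟩ := hA1
  have : IsCompact (Set.univ.pi fun _ : Fin d => Set.univ.pi fun _ : Fin d => Icc (-c⁻¹) c⁻¹) :=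
    isCompact_univ_pi fun _ => isCompact_univ_pi fun _ => isCompact_Icc
  refine this.of_isClosed_subset (Kset_closed hA2) ?_
  intro M hM i _ j _
  have h1 := (hcoer (Matrix.of M)).trans hM
  rw [← ENNReal.ofReal_one, ENNReal.ofReal_le_ofReal_iff zero_le_one] at h1
  have h2 : matnorm (Matrix.of M) ≤ c⁻¹ := by
    rw [← one_div, le_div_iff₀ hc]; linarith
  have h3 := (abs_entry_le (Matrix.of M) i j).trans h2
  exact abs_le.1 h3

lemma Kset_convex {d : ℕ} {f : Matd d → ℝ≥0∞} (hA1 : CostA1 f) : Convex ℝ (Kset f) := by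
  obtain ⟨-, -, hsub, hhom⟩ := hA1
  intro M hM N hN a b ha hb hab
  have hM' : f (Matrix.of M) ≤ 1 := hM
  have hN' : f (Matrix.of N) ≤ 1 := hN
  change f (a • Matrix.of M + b • Matrix.of N) ≤ 1
  refine (hsub _ _).trans ?_
  rw [hhom a ha, hhom b hb]
  calc _ ≤ ENNReal.ofReal a * 1 + ENNReal.ofReal b * 1 := by gcongr
    _ = 1 := by rw [mul_one, mul_one, ← ENNReal.ofReal_add ha hb, hab, ENNReal.ofReal_one]


lemma frob_integral {d : ℕ} (A : Matd d) (κ : Measure (Fin d → Fin d → ℝ))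
    (hκ : Integrable (fun M => M) κ) :
    ∫ M, (1/2 : ℝ) * frob A (Matrix.of M) ∂κ = (1/2 : ℝ) * frob A (Matrix.of (∫ M, M ∂κ)) := by
  let T : (Fin d → Fin d → ℝ) →ₗ[ℝ] ℝ :=
    { toFun := fun M => (1/2 : ℝ) * frob A (Matrix.of M)
      map_add' := fun M N => by
        simp only [frob, Matrix.of_apply, Pi.add_apply, mul_add, Finset.sum_add_distrib]
      map_smul' := fun t M => by
        have : Matrix.of (t • M) = t • Matrix.of M := rfl
        rw [this, frob_smul_right]
        simp only [RingHom.id_apply, smul_eq_mul]; ring }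
  exact (LinearMap.toContinuousLinearMap T).integral_comp_comm hκ

/-- the operator `φ ↦ ½∇²φ : M` -/
def Aop {d : ℕ} (f : Matd d → ℝ≥0∞) (X : Set (Ed d)) : C2cSub d →ₗ[ℝ] C(X × Kset f, ℝ) where
  toFun := fun φ => ⟨fun z => (1/2 : ℝ) * frob (hess (φ : Ed d → ℝ) z.1) (Matrix.of z.2.1),
    (frob_cont φ.2).comp (f := fun z : X × Kset f => ((z.1 : Ed d), (z.2 : Fin d → Fin d → ℝ)))
      (by fun_prop)⟩
  map_add' := fun φ ψ => by
    ext z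
    simp only [Submodule.coe_add, ContinuousMap.coe_mk, ContinuousMap.add_apply]
    rw [hess_add φ.2 ψ.2]
    simp only [frob, Matrix.add_apply, add_mul, Finset.sum_add_distrib, mul_add]
  map_smul' := fun c φ => by
    ext z
    simp only [Submodule.coe_smul, ContinuousMap.coe_mk, ContinuousMap.smul_apply,
      RingHom.id_apply, smul_eq_mul]
    rw [hess_smul c φ.2]
    simp only [frob, Matrix.smul_apply, smul_eq_mul, Finset.mul_sum]
    refine Finset.sum_congr rfl fun i _ => Finset.sum_congr rfl fun j _ => by ring

/-- the functional `φ ↦ ∫ φ dν - ∫ φ dμ` -/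
def Lop {d : ℕ} (μ ν : Measure (Ed d)) [IsFiniteMeasure μ] [IsFiniteMeasure ν] :
    C2cSub d →ₗ[ℝ] ℝ where
  toFun := fun φ => ∫ x, (φ : Ed d → ℝ) x ∂ν - ∫ x, (φ : Ed d → ℝ) x ∂μ
  map_add' := fun φ ψ => by
    simp only [Submodule.coe_add, Pi.add_apply]
    rw [integral_add (IsC2c.integrable φ.2 ν) (IsC2c.integrable ψ.2 ν),
      integral_add (IsC2c.integrable φ.2 μ) (IsC2c.integrable ψ.2 μ)]
    ring
  map_smul' := fun c φ => by
    simp only [Submodule.coe_smul, Pi.smul_apply, smul_eq_mul, RingHom.id_apply,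
      integral_const_mul]
    ring

lemma exists_young {d : ℕ} {f : Matd d → ℝ≥0∞} (hA1 : CostA1 f) (hA2 : CostA2 f)
    {X : Set (Ed d)} (hX : IsCompact X)
    (μ ν : Measure (Ed d)) [IsFiniteMeasure μ] [IsFiniteMeasure ν] (C : ℝ) (hC : 0 ≤ C)
    (h : ∀ φ, Adm f X φ → ∫ x, φ x ∂ν - ∫ x, φ x ∂μ ≤ C) :
    ∃ η : Measure (Ed d × (Fin d → Fin d → ℝ)), IsFiniteMeasure η ∧
      η univ ≤ ENNReal.ofReal C ∧ (∀ᵐ z ∂η, z.2 ∈ Kset f) ∧ (∀ᵐ z ∂η, z.1 ∈ X) ∧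
      ∀ φ, IsC2c φ → ∫ z, (1/2 : ℝ) * frob (hess φ z.1) (Matrix.of z.2) ∂η =
        ∫ x, φ x ∂ν - ∫ x, φ x ∂μ := by
  have hKc := Kset_compact hA1 hA2
  have : CompactSpace X := isCompact_iff_compactSpace.1 hX
  have : CompactSpace (Kset f) := isCompact_iff_compactSpace.1 hKc
  obtain ⟨η, hη, hηC, hηL⟩ := rep_aux (Aop f X) (Lop μ ν) C hC
    (fun φ hφ => h φ ⟨φ.2, fun x hx M hM => hφ (⟨x, hx⟩, ⟨M, hM⟩)⟩)
  have hι : Continuous fun z : X × Kset f => ((z.1 : Ed d), (z.2 : Fin d → Fin d → ℝ)) := by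
    fun_prop
  refine ⟨η.map fun z : X × Kset f => ((z.1 : Ed d), (z.2 : Fin d → Fin d → ℝ)),
    inferInstance, ?_, ?_, ?_, ?_⟩
  · rw [Measure.map_apply hι.measurable MeasurableSet.univ, preimage_univ]
    exact hηC
  · rw [ae_map_iff hι.aemeasurable (measurable_snd hKc.measurableSet)]
    exact Eventually.of_forall fun z => z.2.2
  · rw [ae_map_iff hι.aemeasurable (measurable_fst hX.measurableSet)]
    exact Eventually.of_forall fun z => z.1.2
  · intro φ hφ
    rw [integral_map hι.aemeasurable (frob_cont hφ).measurable.aestronglyMeasurable]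
    exact hηL ⟨φ, hφ⟩

lemma strong_duality {d : ℕ} {f : Matd d → ℝ≥0∞} (hA1 : CostA1 f) (hA2 : CostA2 f)
    {X : Set (Ed d)} (hX : IsCompact X)
    (μ ν : Measure (Ed d)) [IsFiniteMeasure μ] [IsFiniteMeasure ν] (C : ℝ) (hC : 0 ≤ C)
    (h : ∀ φ, Adm f X φ → ∫ x, φ x ∂ν - ∫ x, φ x ∂μ ≤ C) :
    Fstat f X μ ν ≤ ENNReal.ofReal C := by
  have hKc := Kset_compact hA1 hA2
  obtain ⟨η', hfin, hηC, hη'K, hη'X, hηL⟩ := exists_young hA1 hA2 hX μ ν C hC h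
  obtain ⟨κ, hκ, hdis⟩ : ∃ κ : ProbabilityTheory.Kernel (Ed d) (Fin d → Fin d → ℝ),
      ProbabilityTheory.IsMarkovKernel κ ∧ η'.fst.compProd κ = η' :=
    ⟨η'.condKernel, inferInstance, η'.disintegrate _⟩
  have hκK : ∀ᵐ x ∂η'.fst, ∀ᵐ M ∂κ x, M ∈ Kset f := by
    rw [← hdis] at hη'K
    exact Measure.ae_ae_of_ae_compProd hη'K
  have hbdd : ∀ x, (∀ᵐ M ∂κ x, M ∈ Kset f) → Integrable (fun M => M) (κ x) := by
    intro x hx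
    obtain ⟨R, hR⟩ := hKc.isBounded.exists_norm_le
    exact Integrable.of_bound measurable_id.aestronglyMeasurable R (hx.mono fun M hM => hR M hM)
  let ρ : Ed d → Matd d := fun x =>
    if (∀ᵐ M ∂κ x, M ∈ Kset f) then Matrix.of (∫ M, M ∂κ x) else 0
  have hf0 : f 0 = 0 := by
    have := hA1.2.2.2 0 le_rfl 0
    simpa using this
  have hρK : ∀ x, f (ρ x) ≤ 1 := by
    intro x
    simp only [ρ]
    split_ifs with hx
    · exact (Kset_convex hA1).integral_mem hKc.isClosed hx (hbdd x hx)
    · rw [hf0]; exact zero_le_one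
  refine sInf_le_of_le ⟨η'.fst, ρ, ⟨inferInstance, ?_, ?_, ?_⟩, rfl⟩ ?_
  · rw [Measure.fst_apply hX.measurableSet.compl]
    exact hη'X
  · exact fun x => hA1.1 _ (ne_top_of_le_ne_top ENNReal.one_ne_top (hρK x))
  · intro φ hφ
    rw [← hηL φ hφ]
    have h_intg : Integrable (fun z : Ed d × (Fin d → Fin d → ℝ) =>
        (1/2 : ℝ) * frob (hess φ z.1) (Matrix.of z.2)) η' := by
      obtain ⟨R, hR⟩ := ((hX.prod hKc).image (frob_cont hφ)).isBounded.exists_norm_le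
      refine Integrable.of_bound (frob_cont hφ).measurable.aestronglyMeasurable R ?_
      filter_upwards [hη'K, hη'X] with z h1 h2
      exact hR _ ⟨z, ⟨h2, h1⟩, rfl⟩
    conv_rhs => rw [← hdis]
    rw [Measure.integral_compProd (by rw [hdis]; exact h_intg)]
    refine integral_congr_ae ?_
    filter_upwards [hκK] with x hx
    simp only [ρ, if_pos hx]
    exact (frob_integral _ _ (hbdd x hx)).symm
  · calc ∫⁻ x, f (ρ x) ∂η'.fst ≤ ∫⁻ x, 1 ∂η'.fst := lintegral_mono hρK
      _ = η'.fst univ := by simp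
      _ = η' univ := Measure.fst_univ
      _ ≤ _ := hηC

lemma Fstat_eq {d : ℕ} {f : Matd d → ℝ≥0∞} (hA1 : CostA1 f) (hA2 : CostA2 f)
    {X : Set (Ed d)} (hX : IsCompact X)
    (μ ν : Measure (Ed d)) [IsFiniteMeasure μ] [IsFiniteMeasure ν] (C : ℝ≥0∞)
    (h : ∀ φ, Adm f X φ → ENNReal.ofReal (∫ x, φ x ∂ν - ∫ x, φ x ∂μ) ≤ C) :
    Fstat f X μ ν ≤ C := by
  rcases eq_or_ne C ⊤ with rfl | hC
  · exact le_top
  rw [← ENNReal.ofReal_toReal hC]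
  refine strong_duality hA1 hA2 hX μ ν _ ENNReal.toReal_nonneg fun φ hφ => ?_
  exact (ENNReal.ofReal_le_iff_le_toReal hC).1 (h φ hφ)


lemma exists_countable_dual {d : ℕ} {f : Matd d → ℝ≥0∞} (hA1 : CostA1 f) (hA2 : CostA2 f)
    {X : Set (Ed d)} (hX : IsCompact X) :
    ∃ φ : ℕ → Ed d → ℝ, (∀ n, IsC2c (φ n)) ∧ ∀ y ∈ X, ∀ p : Measure (Ed d),
      IsProbabilityMeasure p → p Xᶜ = 0 →
      Gcost f X y p = ⨆ n, ENNReal.ofReal (∫ x, φ n x ∂p - φ n y) := by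
  have : CompactSpace X := isCompact_iff_compactSpace.1 hX
  let S : Set C(X, ℝ) := {g | ∃ φ, Adm f X φ ∧ ∀ x : X, g x = φ x}
  have hS : Nonempty S := by
    refine ⟨⟨0, 0, ⟨(C2cSub d).zero_mem, fun x _ M _ => ?_⟩, fun x => rfl⟩⟩
    have : hess (0 : Ed d → ℝ) x = 0 := by
      have := hess_smul (0 : ℝ) (φ := (0 : Ed d → ℝ)) (C2cSub d).zero_mem x
      simpa using this
    rw [this]; simp [frob]
  choose φ hφ1 hφ2 using fun n => (TopologicalSpace.denseSeq S n).2
  refine ⟨φ, fun n => (hφ1 n).1, fun y hy p hp hpX => le_antisymm ?_ ?_⟩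
  · refine Fstat_eq hA1 hA2 hX _ _ _ fun ψ hψ => ?_
    rw [integral_dirac]
    refine ENNReal.le_of_forall_pos_le_add fun ε hε _ => ?_
    let g : S := ⟨⟨fun x => ψ x, hψ.1.1.continuous.comp continuous_subtype_val⟩,
      ψ, hψ, fun x => rfl⟩
    have hε' : (0 : ℝ) < (ε : ℝ) / 2 := by positivity
    obtain ⟨n, hn⟩ := (TopologicalSpace.denseRange_denseSeq S).exists_dist_lt g hε'
    have hd : ∀ x ∈ X, |ψ x - φ n x| ≤ (ε : ℝ) / 2 := by
      intro x hx
      have h1 : dist (g : C(X, ℝ)) (TopologicalSpace.denseSeq S n : C(X, ℝ)) < ε / 2 := hn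
      have h2 := (ContinuousMap.dist_apply_le_dist (⟨x, hx⟩ : X)).trans h1.le
      rw [hφ2 n, Real.dist_eq] at h2
      exact h2
    have hi : ∫ x, ψ x ∂p - ∫ x, φ n x ∂p ≤ (ε : ℝ) / 2 := by
      rw [← integral_sub (hψ.1.integrable p) ((hφ1 n).1.integrable p)]
      have hae : ∀ᵐ x ∂p, x ∈ X := hpX
      calc ∫ x, (ψ x - φ n x) ∂p ≤ ∫ x, (ε : ℝ) / 2 ∂p := by
            refine integral_mono_ae ((hψ.1.integrable p).sub ((hφ1 n).1.integrable p))
              (integrable_const _) ?_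
            filter_upwards [hae] with x hx using (le_abs_self _).trans (hd x hx)
        _ = (ε : ℝ) / 2 := by simp
    have h3 := (abs_le.1 (hd y hy)).1
    calc ENNReal.ofReal (∫ x, ψ x ∂p - ψ y)
        ≤ ENNReal.ofReal ((∫ x, φ n x ∂p - φ n y) + ε) :=
          ENNReal.ofReal_le_ofReal (by linarith)
      _ ≤ ENNReal.ofReal (∫ x, φ n x ∂p - φ n y) + ENNReal.ofReal ε := ENNReal.ofReal_add_le
      _ ≤ _ := by
        rw [ENNReal.ofReal_coe_nnreal]
        gcongr
        exact le_iSup (fun n => ENNReal.ofReal (∫ x, φ n x ∂p - φ n y)) n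
  · refine iSup_le fun n => ?_
    have := weak_duality hA1 (Measure.dirac y) p (hφ1 n)
    rwa [integral_dirac] at this

lemma integral_bind_aux {α : Type*} [MeasurableSpace α] (p : Measure α)
    (κ : α → Measure α) (hκ : Measurable κ) (ψ : α → ℝ) (hi : Integrable ψ (p.bind κ)) :
    ∫ z, ψ z ∂(p.bind κ) = ∫ y, ∫ z, ψ z ∂κ y ∂p := by
  let k : ProbabilityTheory.Kernel α α := ⟨κ, hκ⟩
  have e : (k.comp (ProbabilityTheory.Kernel.const α p)) = 
      ProbabilityTheory.Kernel.const α (p.bind κ) := by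
    ext a : 1
    rw [ProbabilityTheory.Kernel.comp_apply]
    simp only [ProbabilityTheory.Kernel.const_apply]
    rfl
  rcases isEmpty_or_nonempty α with h | ⟨⟨a⟩⟩
  · have h0 : p = 0 := Measure.eq_zero_of_isEmpty p
    subst h0
    simp
  have h := ProbabilityTheory.Kernel.integral_comp (η := k)
    (κ := ProbabilityTheory.Kernel.const α p) (a := a) (f := ψ) (by rw [e]; exact hi)
  rw [e] at h
  exact h

set_option maxHeartbeats 1000000 in
lemma Hcost_triangle {d : ℕ} {f : Matd d → ℝ≥0∞} (hA1 : CostA1 f) (hA2 : CostA2 f)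
    {X : Set (Ed d)} (hX : IsCompact X) (μ₁ μ₂ μ₃ : Measure (Ed d)) :
    Hcost f X μ₁ μ₃ ≤ Hcost f X μ₁ μ₂ + Hcost f X μ₂ μ₃ := by
  unfold Hcost
  rw [ENNReal.sInf_add, ]
  refine le_iInf₂ ?_
  rintro _ ⟨κ₁, ⟨hp1, hm1, hb1⟩, rfl⟩
  rw [add_comm, ENNReal.sInf_add]
  refine le_iInf₂ ?_
  rintro _ ⟨κ₂, ⟨hp2, hm2, hb2⟩, rfl⟩
  rw [add_comm]
  have hκ1 : Measurable κ₁ := Measure.measurable_of_measurable_coe _ hm1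
  have hκ2 : Measurable κ₂ := Measure.measurable_of_measurable_coe _ hm2
  have hμ2 : μ₂ = μ₁.bind κ₁ := by
    ext A hA
    rw [Measure.bind_apply hA hκ1.aemeasurable, hb1 A hA]
  have hpr1 : ∀ x, IsProbabilityMeasure (κ₁ x) := fun x => (hp1 x).1
  have hpr2 : ∀ x, IsProbabilityMeasure (κ₂ x) := fun x => (hp2 x).1
  obtain ⟨φ, hφ, hG⟩ := exists_countable_dual hA1 hA2 hX
  let k₂ : ProbabilityTheory.Kernel (Ed d) (Ed d) := ⟨κ₂, hκ2⟩
  have hk₂ : ProbabilityTheory.IsMarkovKernel k₂ := ⟨hpr2⟩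
  have h_int_meas : ∀ ψ : Ed d → ℝ, IsC2c ψ → Measurable fun y => ∫ x, ψ x ∂κ₂ y := by
    intro ψ hψ
    have : StronglyMeasurable fun y => ∫ x, ψ x ∂k₂ y :=
      StronglyMeasurable.integral_kernel hψ.1.continuous.stronglyMeasurable
    exact this.measurable
  let g : Ed d → ℝ≥0∞ := fun y => ⨆ n, ENNReal.ofReal (∫ x, φ n x ∂κ₂ y - φ n y)
  have hg : Measurable g := by
    refine Measurable.iSup fun n => ?_
    exact ((h_int_meas _ (hφ n)).sub (hφ n).1.continuous.measurable).ennreal_ofReal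
  have hgG : ∀ y ∈ X, Gcost f X y (κ₂ y) = g y := fun y hy => hG y hy _ (hp2 y).1 (hp2 y).2
  have hμ2X : ∀ᵐ y ∂μ₂, y ∈ X := by
    change μ₂ Xᶜ = 0
    rw [← hb1 _ hX.measurableSet.compl]
    simp [(hp1 _).2]
  let κ : Ed d → Measure (Ed d) := fun x => (κ₁ x).bind κ₂
  have hκ : Measurable κ := Measure.measurable_bind' hκ2 |>.comp hκ1
  have hκapp : ∀ x A, MeasurableSet A → κ x A = ∫⁻ y, κ₂ y A ∂κ₁ x := fun x A hA =>
    Measure.bind_apply hA hκ2.aemeasurable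
  have hpr : ∀ x, IsProbabilityMeasure (κ x) := fun x => ⟨by
    rw [hκapp _ _ MeasurableSet.univ]; simp⟩
  have hT : IsTransportKernel X μ₁ μ₃ κ := by
    refine ⟨fun x => ⟨hpr x, ?_⟩, fun A hA => (Measure.measurable_coe hA).comp hκ, fun A hA => ?_⟩
    · rw [hκapp _ _ hX.measurableSet.compl]; simp [(hp2 _).2]
    · rw [← hb2 A hA, hμ2, Measure.lintegral_bind hκ1.aemeasurable (hm2 A hA).aemeasurable]
      exact lintegral_congr fun x => hκapp x A hA
  refine sInf_le_of_le ⟨κ, hT, rfl⟩ ?_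
  have hpt : ∀ x, Gcost f X x (κ x) ≤ Gcost f X x (κ₁ x) + ∫⁻ y, g y ∂κ₁ x := by
    intro x
    have := hpr x
    refine Fstat_eq hA1 hA2 hX _ _ _ fun ψ hψ => ?_
    have hae : ∀ᵐ y ∂κ₁ x, y ∈ X := (hp1 x).2
    obtain ⟨B, hB⟩ := hψ.1.1.continuous.bounded_above_of_compact_support hψ.1.2
    have hi2 : Integrable (fun y => ∫ z, ψ z ∂κ₂ y) (κ₁ x) := by
      refine Integrable.of_bound (h_int_meas ψ hψ.1).aestronglyMeasurable B
        (Eventually.of_forall fun y => ?_)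
      have := norm_integral_le_of_norm_le_const (μ := κ₂ y) (Eventually.of_forall hB)
      simpa using this
    have hi1 := hψ.1.integrable (κ₁ x)
    have hbind : ∫ z, ψ z ∂κ x = ∫ y, ∫ z, ψ z ∂κ₂ y ∂κ₁ x := by
      exact integral_bind_aux (κ₁ x) κ₂ hκ2 ψ (hψ.1.integrable (κ x))
    have h1 : ENNReal.ofReal (∫ y, (∫ z, ψ z ∂κ₂ y - ψ y) ∂κ₁ x) ≤ ∫⁻ y, g y ∂κ₁ x := by
      have hi : Integrable (fun y => ∫ z, ψ z ∂κ₂ y - ψ y) (κ₁ x) := hi2.sub hi1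
      rw [integral_eq_lintegral_pos_part_sub_lintegral_neg_part hi]
      refine (ENNReal.ofReal_le_ofReal (sub_le_self _ ENNReal.toReal_nonneg)).trans ?_
      refine ENNReal.ofReal_toReal_le.trans (lintegral_mono_ae ?_)
      filter_upwards [hae] with y hy
      rw [← hgG y hy]
      have := weak_duality hA1 (Measure.dirac y) (κ₂ y) hψ
      rwa [integral_dirac] at this
    have h2 := weak_duality hA1 (Measure.dirac x) (κ₁ x) hψ
    have h3 : ∫ z, ψ z ∂κ x - ∫ z, ψ z ∂Measure.dirac x =
        (∫ z, ψ z ∂κ₁ x - ∫ z, ψ z ∂Measure.dirac x) +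
          ∫ y, (∫ z, ψ z ∂κ₂ y - ψ y) ∂κ₁ x := by
      rw [integral_sub hi2 hi1, hbind]; ring
    rw [h3]
    exact ENNReal.ofReal_add_le.trans (add_le_add h2 h1)
  calc ∫⁻ x, Gcost f X x (κ x) ∂μ₁
      ≤ ∫⁻ x, (Gcost f X x (κ₁ x) + ∫⁻ y, g y ∂κ₁ x) ∂μ₁ := lintegral_mono hpt
    _ = ∫⁻ x, Gcost f X x (κ₁ x) ∂μ₁ + ∫⁻ x, ∫⁻ y, g y ∂κ₁ x ∂μ₁ :=
        lintegral_add_right _ ((Measure.measurable_lintegral hg).comp hκ1)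
    _ = ∫⁻ x, Gcost f X x (κ₁ x) ∂μ₁ + ∫⁻ y, Gcost f X y (κ₂ y) ∂μ₂ := by
        congr 1
        rw [← Measure.lintegral_bind hκ1.aemeasurable hg.aemeasurable, ← hμ2]
        refine lintegral_congr_ae ?_
        filter_upwards [hμ2X] with y hy using (hgG y hy).symm

end
/-- Proposition 3.16. `H` satisfies the triangle inequality on `M(X)`. -/
theorem stmt9 {d : ℕ} (hd : 0 < d) (f : Matd d → ℝ≥0∞) (hA1 : CostA1 f) (hA2 : CostA2 f)
    (Ω X : Set (Ed d)) (hΩopen : IsOpen Ω) (hΩconv : Convex ℝ Ω)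
    (hΩbdd : Bornology.IsBounded Ω) (hΩne : Ω.Nonempty) (hX : X = closure Ω)
    (μ₁ μ₂ μ₃ : SignedMeasure (Ed d))
    (h₁ : SuppInX X μ₁) (h₂ : SuppInX X μ₂) (h₃ : SuppInX X μ₃) :
    HSgn f X μ₁ μ₃ ≤ HSgn f X μ₁ μ₂ + HSgn f X μ₂ μ₃ := by
  have hXc : IsCompact X := by
    rw [hX]; exact hΩbdd.isCompact_closure
  by_cases h12 : 0 ≤ μ₁ ∧ 0 ≤ μ₂ ∧ μ₁ univ = μ₂ univ
  · by_cases h23 : 0 ≤ μ₂ ∧ 0 ≤ μ₃ ∧ μ₂ univ = μ₃ univ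
    · have h13 : 0 ≤ μ₁ ∧ 0 ≤ μ₃ ∧ μ₁ univ = μ₃ univ :=
        ⟨h12.1, h23.2.1, h12.2.2.trans h23.2.2⟩
      unfold HSgn
      rw [if_pos h12, if_pos h23, if_pos h13]
      exact Hcost_triangle hA1 hA2 hXc _ _ _
    · have : HSgn f X μ₂ μ₃ = ⊤ := if_neg h23
      rw [this, add_top]; exact le_top
  · have : HSgn f X μ₁ μ₂ = ⊤ := if_neg h12
    rw [this, top_add]; exact le_top
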